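/- For any p ∈ [1,2) and q ≥ 1 there exists a sequence (ε_m(p))_{m≥1} with m^a ε_m(p) → 0 as m → ∞ for every a > 0, such that for all m ≥ 1, sup over all probability densities 𝔭 on ℝ^d of E_𝔭[ sup_{h⃗ ∈ ℋ^d_m} ( ‖ξ_m(·,h⃗)‖_p − ‖K‖₁^{-1} Δ_m(h⃗) )₊^q ] ≤ ε_m(p)^q. -/

import Mathlib

open MeasureTheory Filter

noncomputable section

/-- The `L_p(ℝ^d)` (semi-)norm `(∫ |f|^p)^{1/p}` of a real function, for finite `p ≥ 1`. -/
def lpNorm {d : ℕ} (p : ℝ) (f : (Fin d → ℝ) → ℝ) : ℝ :=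
  (∫ x : Fin d → ℝ, |f x| ^ p) ^ (1 / p)

/-- The `L_∞(ℝ^d)` norm (essential supremum of `|f|`). -/
def linfNorm {d : ℕ} (f : (Fin d → ℝ) → ℝ) : ℝ :=
  (eLpNorm f ⊤ volume).toReal

/-- `f` is a probability density on `ℝ^d` (w.r.t. Lebesgue measure). -/
def IsDensity {d : ℕ} (f : (Fin d → ℝ) → ℝ) : Prop :=
  (∀ x, 0 ≤ f x) ∧ Integrable f ∧ ∫ x, f x = 1

/-- The probability measure on `ℝ^d` with density `f`. -/
def densMeasure {d : ℕ} (f : (Fin d → ℝ) → ℝ) : Measure (Fin d → ℝ) :=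
  volume.withDensity fun x => ENNReal.ofReal (f x)

/-- The joint law of `m` i.i.d. observations with common density `f`. -/
def sampleMeasure {d : ℕ} (f : (Fin d → ℝ) → ℝ) (m : ℕ) :
    Measure (Fin m → Fin d → ℝ) :=
  Measure.pi fun _ => densMeasure f

/-- A kernel: continuous, bounded, symmetric, integrable, with `∫ K = 1`. -/
def IsGoodKernel {d : ℕ} (K : (Fin d → ℝ) → ℝ) : Prop :=
  Continuous K ∧ (∃ C, ∀ x, |K x| ≤ C) ∧ (∀ x, K (-x) = K x) ∧
    Integrable K ∧ ∫ x, K x = 1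

/-- The scaled kernel `K_{h}(t) = (∏ h_j)⁻¹ K(t₁/h₁,…,t_d/h_d)`. -/
def scaledKernel {d : ℕ} (K : (Fin d → ℝ) → ℝ) (h : Fin d → ℝ) (t : Fin d → ℝ) : ℝ :=
  (∏ j, h j)⁻¹ * K fun j => t j / h j

/-- The dyadic grid `ℋ^d = {(2^{-k₁},…,2^{-k_d}) : k ∈ ℕ^d}`. -/
def dyadicGrid (d : ℕ) : Set (Fin d → ℝ) :=
  {h | ∃ k : Fin d → ℕ, ∀ j, h j = (2 : ℝ) ^ (-(k j : ℤ))}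

/-- The bandwidth set `ℋ^d_m = {h ∈ ℋ^d : ln(m)/m ≤ ∏ h_j ≤ e^{-√(ln m)}}`. -/
def bandwidthSet (d m : ℕ) : Set (Fin d → ℝ) :=
  {h | h ∈ dyadicGrid d ∧ Real.log m / m ≤ ∏ j, h j ∧
        ∏ j, h j ≤ Real.exp (-Real.sqrt (Real.log m))}

/-- The smoothed empirical process
`ξ_m(x,h) = m⁻¹ ∑_i [K_h(T_i − x) − E_𝔭 K_h(T_1 − x)]`. -/
def empProc {d : ℕ} (K : (Fin d → ℝ) → ℝ) (𝔭 : (Fin d → ℝ) → ℝ) (m : ℕ)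
    (ω : Fin m → Fin d → ℝ) (x h : Fin d → ℝ) : ℝ :=
  (m : ℝ)⁻¹ * ∑ i, (scaledKernel K h (ω i - x) - ∫ z, scaledKernel K h (z - x) * 𝔭 z)

/-- The threshold `Δ_m(h) = 128 ‖K‖₁ ‖K‖_p (m V_h)^{1/p−1}`, used for `1 ≤ p < 2`. -/
def deltaLow {d : ℕ} (K : (Fin d → ℝ) → ℝ) (p : ℝ) (m : ℕ) (h : Fin d → ℝ) : ℝ :=
  128 * lpNorm 1 K * lpNorm p K * ((m : ℝ) * ∏ j, h j) ^ (1 / p - 1)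

/-- The threshold `Δ_m(h) = 9 ‖K‖₁ ‖K‖₂ (m V_h)^{-1/2}`, used for `p = 2`. -/
def deltaTwo {d : ℕ} (K : (Fin d → ℝ) → ℝ) (m : ℕ) (h : Fin d → ℝ) : ℝ :=
  9 * lpNorm 1 K * lpNorm 2 K * ((m : ℝ) * ∏ j, h j) ^ (-(1 / 2) : ℝ)

/-- The empirical threshold used for `p > 2`:
`Δ_m(h) = (480 p ‖K‖₁/ln p){ m^{-1/2} (∫ [m⁻¹ ∑ K²_h(T_i−t)]^{p/2} dt)^{1/p}
  + 2 ‖K‖_p (m V_h)^{-1/2} }`. -/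
def deltaEmp {d : ℕ} (K : (Fin d → ℝ) → ℝ) (p : ℝ) (m : ℕ)
    (ω : Fin m → Fin d → ℝ) (h : Fin d → ℝ) : ℝ :=
  480 * p * lpNorm 1 K / Real.log p *
    ((m : ℝ) ^ (-(1 / 2) : ℝ) *
        (∫ t : Fin d → ℝ,
            ((m : ℝ)⁻¹ * ∑ i, (scaledKernel K h (ω i - t)) ^ 2) ^ (p / 2)) ^ (1 / p)
      + 2 * lpNorm p K * ((m : ℝ) * ∏ j, h j) ^ (-(1 / 2) : ℝ))

/-- The case-dependent threshold `Δ_m(h)` of the paper. -/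
def deltaUpper {d : ℕ} (K : (Fin d → ℝ) → ℝ) (p : ℝ) (m : ℕ)
    (ω : Fin m → Fin d → ℝ) (h : Fin d → ℝ) : ℝ :=
  if p < 2 then deltaLow K p m h
  else if p = 2 then deltaTwo K m h
  else deltaEmp K p m ω h

/-- Fubini for one coordinate. -/
lemma integral_pi_succ {E : Type*} [MeasurableSpace E] (μ : Measure E) [IsProbabilityMeasure μ]
    {n : ℕ} {F : (Fin (n + 1) → E) → ℝ} (hF : Measurable F) {B : ℝ} (hB : ∀ ω, |F ω| ≤ B) :
    ∫ ω, F ω ∂(Measure.pi fun _ : Fin (n + 1) => μ)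
      = ∫ ω, ∫ z, F (Fin.cons z ω) ∂μ ∂(Measure.pi fun _ : Fin n => μ) := by
  have hmp := (measurePreserving_piFinSuccAbove (fun _ : Fin (n + 1) => μ) 0).symm
  rw [← hmp.integral_comp' F, integral_prod_symm]
  · simp only [MeasurableEquiv.piFinSuccAbove_symm_apply, Fin.insertNthEquiv,
      Equiv.coe_fn_mk, Fin.insertNth_zero]
    rfl
  · refine Integrable.of_bound (C := B) ?_ (Eventually.of_forall fun x => hB _)
    exact (hF.comp (MeasurableEquiv.measurable _)).aestronglyMeasurable

lemma measurable_cons_uncurry {E : Type*} [MeasurableSpace E] {n : ℕ} :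
    Measurable fun q : (Fin n → E) × E => (Fin.cons q.2 q.1 : Fin (n + 1) → E) := by
  refine measurable_pi_iff.2 fun i => ?_
  refine Fin.cases ?_ (fun j => ?_) i
  · simpa using measurable_snd
  · simpa [Function.comp_def] using (measurable_pi_apply j).comp measurable_fst

/-- McDiarmid's bounded difference inequality, in exponential moment form. -/
lemma bounded_difference_mgf {E : Type*} [MeasurableSpace E] (μ : Measure E)
    [IsProbabilityMeasure μ] {c : ℝ} (t : ℝ) (n : ℕ) :
    ∀ {F : (Fin n → E) → ℝ} {B : ℝ}, Measurable F → (∀ ω, |F ω| ≤ B) →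
      (∀ ω ω' i, (∀ j, j ≠ i → ω j = ω' j) → |F ω - F ω'| ≤ c) →
      ∫ ω, Real.exp (t * (F ω - ∫ η, F η ∂(Measure.pi fun _ : Fin n => μ)))
          ∂(Measure.pi fun _ : Fin n => μ)
        ≤ Real.exp (n * (c ^ 2 * t ^ 2 / 2)) := by
  induction n with
  | zero =>
    intro F B hF hB hd
    have : ∀ ω, F ω = F default := fun ω => congrArg F (Subsingleton.elim _ _)
    simp [this]
  | succ n ih =>
    intro F B hF hB hd
    set P := Measure.pi fun _ : Fin n => μ with hP
    set G : (Fin n → E) → ℝ := fun ω => ∫ z, F (Fin.cons z ω) ∂μ with hG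
    have hFc : Measurable fun q : (Fin n → E) × E => F (Fin.cons q.2 q.1) :=
      hF.comp measurable_cons_uncurry
    have hGm : Measurable G :=
      (StronglyMeasurable.integral_prod_right'
        (f := fun (q : (Fin n → E) × E) => F (Fin.cons q.2 q.1))
        hFc.stronglyMeasurable).measurable
    have hsec : ∀ ω, Measurable fun z => F (Fin.cons z ω : Fin (n + 1) → E) := fun ω =>
      hFc.comp measurable_prodMk_left
    have hint : ∀ ω, Integrable (fun z => F (Fin.cons z ω : Fin (n + 1) → E)) μ := fun ω =>
      Integrable.of_bound (C := B) (hsec ω).aestronglyMeasurable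
        (Eventually.of_forall fun x => hB _)
    have hGB : ∀ ω, |G ω| ≤ B := fun ω => by
      have := norm_integral_le_of_norm_le_const (μ := μ) (C := B)
        (f := fun z => F (Fin.cons z ω : Fin (n + 1) → E)) (Eventually.of_forall fun x => hB _)
      simpa using this
    have hGd : ∀ ω ω' i, (∀ j, j ≠ i → ω j = ω' j) → |G ω - G ω'| ≤ c := by
      intro ω ω' i hij
      rw [hG]
      simp only
      rw [← integral_sub (hint ω) (hint ω')]
      have := norm_integral_le_of_norm_le_const (μ := μ) (C := c)
        (f := fun z => F (Fin.cons z ω : Fin (n + 1) → E) - F (Fin.cons z ω' : Fin (n + 1) → E))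
        (Eventually.of_forall fun z => hd _ _ i.succ fun j => by
          refine Fin.cases (fun _ => rfl) (fun k hk => ?_) j
          simpa using hij k (fun h => hk (h ▸ rfl)))
      simpa using this
    have hmean : ∫ ω, F ω ∂(Measure.pi fun _ : Fin (n + 1) => μ) = ∫ ω, G ω ∂P :=
      integral_pi_succ μ hF hB
    set M := ∫ ω, G ω ∂P with hM
    have hMB : |M| ≤ B := by
      have := norm_integral_le_of_norm_le_const (μ := P) (C := B)
        (f := G) (Eventually.of_forall fun x => hGB _)
      simpa using this
    have hexpB : ∀ {u : ℝ}, |u| ≤ B → |Real.exp (t * (u - M))| ≤ Real.exp (|t| * (B + B)) := by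
      intro u hu
      rw [Real.abs_exp]
      refine Real.exp_le_exp.2 ((le_abs_self _).trans ?_)
      rw [abs_mul]
      gcongr
      exact (abs_sub _ _).trans (add_le_add hu hMB)
    rw [hmean, integral_pi_succ μ (F := fun ω => Real.exp (t * (F ω - M)))
      (by fun_prop) (fun ω => hexpB (hB ω))]
    have hinner : ∀ ω, ∫ z, Real.exp (t * (F (Fin.cons z ω : Fin (n + 1) → E) - M)) ∂μ
        ≤ Real.exp (c ^ 2 * t ^ 2 / 2) * Real.exp (t * (G ω - M)) := by
      intro ω
      obtain ⟨z₀⟩ : Nonempty E := μ.nonempty_of_neZero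
      have hsub := (ProbabilityTheory.hasSubgaussianMGF_of_mem_Icc (μ := μ)
        (X := fun z => F (Fin.cons z ω : Fin (n + 1) → E))
        (a := F (Fin.cons z₀ ω : Fin (n + 1) → E) - c)
        (b := F (Fin.cons z₀ ω : Fin (n + 1) → E) + c) (hsec ω).aemeasurable
        (Eventually.of_forall fun z => by
          have := abs_le.1 (hd (Fin.cons z ω) (Fin.cons z₀ ω) 0 fun j => by
            refine Fin.cases (fun h => absurd rfl h) (fun k _ => ?_) j
            simp)
          constructor <;> linarith)).mgf_le t
      have hexp : ∀ z, Real.exp (t * (F (Fin.cons z ω : Fin (n + 1) → E) - M))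
          = Real.exp (t * (F (Fin.cons z ω : Fin (n + 1) → E) - G ω))
            * Real.exp (t * (G ω - M)) := fun z => by
        rw [← Real.exp_add]; ring_nf
      simp_rw [hexp]
      rw [integral_mul_const]
      refine mul_le_mul_of_nonneg_right ?_ (Real.exp_pos _).le
      refine hsub.trans (Real.exp_le_exp.2 (le_of_eq ?_))
      push_cast
      rw [show F (Fin.cons z₀ ω) + c - (F (Fin.cons z₀ ω) - c) = 2 * c by ring]
      simp
    calc _ ≤ ∫ ω, Real.exp (c ^ 2 * t ^ 2 / 2) * Real.exp (t * (G ω - M)) ∂P := by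
          refine integral_mono_of_nonneg (Eventually.of_forall fun ω =>
            integral_nonneg fun z => (Real.exp_pos _).le) ?_ (Eventually.of_forall hinner)
          refine Integrable.const_mul (Integrable.of_bound (C := Real.exp (|t| * (B + B)))
            ?_ (Eventually.of_forall fun ω => hexpB (hGB ω))) _
          exact (by fun_prop : Measurable fun ω => Real.exp (t * (G ω - M))).aestronglyMeasurable
      _ ≤ Real.exp (c ^ 2 * t ^ 2 / 2) * Real.exp (n * (c ^ 2 * t ^ 2 / 2)) := by
          rw [integral_const_mul]
          exact mul_le_mul_of_nonneg_left (ih hGm hGB hGd) (Real.exp_pos _).le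
      _ = _ := by rw [← Real.exp_add]; push_cast; ring_nf

/-- The signed power `sign s * |s| ^ r`. -/
def signedPow (r s : ℝ) : ℝ := Real.sign s * |s| ^ r

lemma signedPow_neg (r s : ℝ) : signedPow r (-s) = -signedPow r s := by
  simp [signedPow, Real.sign_neg]

lemma signedPow_of_pos {r s : ℝ} (hs : 0 < s) : signedPow r s = s ^ r := by
  simp [signedPow, Real.sign_of_pos hs, abs_of_pos hs]

lemma abs_signedPow_le (r s : ℝ) : |signedPow r s| ≤ |s| ^ r := by
  rw [signedPow, abs_mul, abs_of_nonneg (Real.rpow_nonneg (abs_nonneg s) r)]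
  refine mul_le_of_le_one_left (Real.rpow_nonneg (abs_nonneg s) r) ?_
  rcases Real.sign_apply_eq s with h | h | h <;> simp [h]

lemma rpow_sub_rpow_le {r x y : ℝ} (hr : 0 ≤ r) (hr1 : r ≤ 1) (hx : 0 ≤ x) (hxy : x ≤ y) :
    y ^ r - x ^ r ≤ (y - x) ^ r := by
  have := Real.rpow_add_le_add_rpow hx (sub_nonneg.2 hxy) hr hr1
  rw [add_sub_cancel] at this
  linarith

lemma abs_signedPow_sub_le {r : ℝ} (hr : 0 ≤ r) (hr1 : r ≤ 1) (x y : ℝ) :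
    |signedPow r x - signedPow r y| ≤ 2 * |x - y| ^ r := by
  have key : ∀ x y : ℝ, 0 < x → 0 < y →
      |signedPow r x - signedPow r y| ≤ 2 * |x - y| ^ r := by
    intro x y hx hy
    rw [signedPow_of_pos hx, signedPow_of_pos hy]
    rcases le_total x y with h | h
    · have h1 := rpow_sub_rpow_le hr hr1 hx.le h
      have h2 := Real.rpow_le_rpow hx.le h hr
      have h3 := Real.rpow_nonneg (sub_nonneg.2 h) r
      rw [abs_of_nonpos (by linarith), abs_of_nonpos (by linarith), neg_sub, neg_sub]
      linarith
    · have h1 := rpow_sub_rpow_le hr hr1 hy.le h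
      have h2 := Real.rpow_le_rpow hy.le h hr
      have h3 := Real.rpow_nonneg (sub_nonneg.2 h) r
      rw [abs_of_nonneg (by linarith), abs_of_nonneg (by linarith)]
      linarith
  have opp : ∀ x y : ℝ, x * y ≤ 0 → |signedPow r x - signedPow r y| ≤ 2 * |x - y| ^ r := by
    intro x y hxy
    have hx : |x| ≤ |x - y| := by
      refine sq_le_sq.1 ?_
      nlinarith [sq_nonneg y]
    have hy : |y| ≤ |x - y| := by
      refine sq_le_sq.1 ?_
      nlinarith [sq_nonneg x]
    have h1 := Real.rpow_le_rpow (abs_nonneg x) hx hr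
    have h2 := Real.rpow_le_rpow (abs_nonneg y) hy hr
    have h3 := abs_signedPow_le r x
    have h4 := abs_signedPow_le r y
    have h5 := abs_sub (signedPow r x) (signedPow r y)
    linarith
  rcases le_or_gt (x * y) 0 with h | h
  · exact opp x y h
  · rcases pos_and_pos_or_neg_and_neg_of_mul_pos h with ⟨hx, hy⟩ | ⟨hx, hy⟩
    · exact key x y hx hy
    · have := key (-x) (-y) (neg_pos.2 hx) (neg_pos.2 hy)
      rw [signedPow_neg, signedPow_neg] at this
      rwa [← abs_neg (x - y), ← abs_neg (signedPow r x - signedPow r y), neg_sub', neg_sub']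

/-- The tangent inequality for the convex function `|·| ^ p`. -/
lemma rpow_abs_tangent_le {p : ℝ} (hp : 1 ≤ p) (x y : ℝ) :
    |x| ^ p + p * signedPow (p - 1) x * (y - x) ≤ |y| ^ p := by
  have hp0 : 0 < p := by linarith
  have hxx : signedPow (p - 1) x * x = |x| ^ p := by
    rcases lt_trichotomy x 0 with h | h | h
    · have h' : 0 < |x| := abs_pos.2 h.ne
      rw [signedPow, Real.sign_of_neg h, mul_right_comm, neg_one_mul, ← abs_of_neg h, mul_comm,
        ← Real.rpow_add_one h'.ne', sub_add_cancel]
    · simp [h, hp0.ne']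
    · rw [signedPow_of_pos h, abs_of_pos h, ← Real.rpow_add_one h.ne', sub_add_cancel]
  have hy : signedPow (p - 1) x * y ≤ |x| ^ (p - 1) * |y| := by
    refine (le_abs_self _).trans ?_
    rw [abs_mul]
    exact mul_le_mul_of_nonneg_right (abs_signedPow_le _ _) (abs_nonneg y)
  have hyoung := Real.geom_mean_le_arith_mean2_weighted (w₁ := (p - 1) / p) (w₂ := 1 / p)
    (p₁ := |x| ^ p) (p₂ := |y| ^ p) (div_nonneg (by linarith) hp0.le) (by positivity)
    (by positivity) (by positivity) (by field_simp; ring)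
  rw [← Real.rpow_mul (abs_nonneg _), ← Real.rpow_mul (abs_nonneg _),
    mul_div_cancel₀ _ hp0.ne', mul_one_div_cancel hp0.ne', Real.rpow_one] at hyoung
  have h2 : p * ((p - 1) / p * |x| ^ p + 1 / p * |y| ^ p) = (p - 1) * |x| ^ p + |y| ^ p := by
    field_simp
  have h3 := mul_le_mul_of_nonneg_left (hy.trans hyoung) hp0.le
  rw [h2] at h3
  linear_combination h3 - p * hxx

lemma rpow_abs_add_le {p : ℝ} (hp : 1 ≤ p) (hp2 : p ≤ 2) (a b : ℝ) :
    |a + b| ^ p ≤ |a| ^ p + p * signedPow (p - 1) a * b + 4 * |b| ^ p := by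
  have h1 := rpow_abs_tangent_le hp (a + b) a
  have h2 := abs_signedPow_sub_le (r := p - 1) (by linarith) (by linarith) (a + b) a
  rw [add_sub_cancel_left] at h2
  have h3 : |b| ^ (p - 1) * |b| ≤ |b| ^ p := by
    rcases eq_or_ne b 0 with h | h
    · simpa [h] using Real.rpow_nonneg le_rfl p
    · rw [← Real.rpow_add_one (abs_pos.2 h).ne', sub_add_cancel]
  have h4 : (signedPow (p - 1) (a + b) - signedPow (p - 1) a) * b
      ≤ 2 * |b| ^ (p - 1) * |b| := by
    refine (le_abs_self _).trans ?_
    rw [abs_mul]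
    exact mul_le_mul_of_nonneg_right h2 (abs_nonneg b)
  have h5 : (0 : ℝ) ≤ |b| ^ p := by positivity
  have h6 := mul_le_mul_of_nonneg_left (h4.trans
    (by rw [mul_assoc]; gcongr : 2 * |b| ^ (p - 1) * |b| ≤ 2 * |b| ^ p))
    (by linarith : (0 : ℝ) ≤ p)
  have h7 : p * (2 * |b| ^ p) ≤ 4 * |b| ^ p := by nlinarith
  nlinarith

/-- The von Bahr–Esseen inequality for sums of bounded centred i.i.d. variables. -/
lemma integral_rpow_abs_sum_le {E : Type*} [MeasurableSpace E] (μ : Measure E)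
    [IsProbabilityMeasure μ] {p : ℝ} (hp : 1 ≤ p) (hp2 : p ≤ 2) {y : E → ℝ} (hy : Measurable y)
    {B : ℝ} (hB : ∀ z, |y z| ≤ B) (h0 : ∫ z, y z ∂μ = 0) (n : ℕ) :
    ∫ ω, |∑ i, y (ω i)| ^ p ∂(Measure.pi fun _ : Fin n => μ) ≤ n * (4 * ∫ z, |y z| ^ p ∂μ) := by
  have hp0 : 0 ≤ p := by linarith
  have hsum : ∀ (n : ℕ) (ω : Fin n → E), |∑ i, y (ω i)| ≤ n * B := fun n ω => by
    refine (Finset.abs_sum_le_sum_abs _ _).trans ((Finset.sum_le_sum fun i _ => hB (ω i)).trans ?_)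
    simp
  have hsumB : ∀ (n : ℕ) (ω : Fin n → E), |(|∑ i, y (ω i)| ^ p)| ≤ (n * B) ^ p := fun n ω => by
    rw [abs_of_nonneg (by positivity)]
    exact Real.rpow_le_rpow (abs_nonneg _) (hsum n ω) hp0
  have hmeas : ∀ n : ℕ, Measurable fun ω : Fin n → E => |∑ i, y (ω i)| ^ p := fun n => by
    fun_prop
  have hyint : Integrable y μ :=
    Integrable.of_bound (C := B) hy.aestronglyMeasurable (Eventually.of_forall hB)
  have hypint : Integrable (fun z => |y z| ^ p) μ := by
    refine Integrable.of_bound (C := B ^ p)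
      (by fun_prop : Measurable fun z => |y z| ^ p).aestronglyMeasurable
      (Eventually.of_forall fun z => ?_)
    rw [Real.norm_eq_abs, abs_of_nonneg (by positivity)]
    exact Real.rpow_le_rpow (abs_nonneg _) (hB z) hp0
  induction n with
  | zero => simp [Real.zero_rpow (by linarith : p ≠ 0)]
  | succ n ih =>
    rw [integral_pi_succ μ (hmeas _) (hsumB _)]
    calc _ ≤ ∫ ω, (|∑ i, y (ω i)| ^ p + 4 * ∫ z, |y z| ^ p ∂μ)
            ∂(Measure.pi fun _ : Fin n => μ) := by
          refine integral_mono_of_nonneg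
            (Eventually.of_forall fun ω => integral_nonneg fun z => by positivity) ?_
            (Eventually.of_forall fun ω => ?_)
          · exact (Integrable.of_bound (hmeas n).aestronglyMeasurable _
              (Eventually.of_forall (hsumB n))).add (integrable_const _)
          · have hint1 : Integrable (fun z => |∑ i, y (ω i)| ^ p
                + p * signedPow (p - 1) (∑ i, y (ω i)) * y z) μ :=
              (integrable_const _).add (hyint.const_mul _)
            calc _ ≤ ∫ z, (|∑ i, y (ω i)| ^ p + p * signedPow (p - 1) (∑ i, y (ω i)) * y z
                    + 4 * |y z| ^ p) ∂μ := by
                  refine integral_mono_of_nonneg (Eventually.of_forall fun z => by positivity)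
                    (hint1.add (hypint.const_mul _)) (Eventually.of_forall fun z => ?_)
                  simp only [Fin.sum_univ_succ, Fin.cons_zero, Fin.cons_succ]
                  rw [add_comm (y z)]
                  exact rpow_abs_add_le hp hp2 _ _
              _ = _ := by
                  rw [integral_add hint1 (hypint.const_mul _),
                    integral_add (integrable_const _) (hyint.const_mul _), integral_const_mul,
                    integral_const_mul, h0]
                  simp
      _ ≤ _ := by
          rw [integral_add (Integrable.of_bound (hmeas n).aestronglyMeasurable _
              (Eventually.of_forall (hsumB n))) (integrable_const _)]
          simp only [integral_const, probReal_univ, one_smul]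
          push_cast
          linarith

lemma lpNorm_eq_toReal_eLpNorm {d : ℕ} {p : ℝ} (hp : 0 < p) {f : (Fin d → ℝ) → ℝ}
    (hf : MemLp f (ENNReal.ofReal p) volume) :
    _root_.lpNorm p f = (eLpNorm f (ENNReal.ofReal p) volume).toReal := by
  rw [hf.eLpNorm_eq_integral_rpow_norm (by simpa using hp) ENNReal.ofReal_ne_top,
    ENNReal.toReal_ofReal hp.le, ENNReal.toReal_ofReal (by positivity), _root_.lpNorm, one_div]
  rfl

lemma lpNorm_nonneg {d : ℕ} (p : ℝ) (f : (Fin d → ℝ) → ℝ) : 0 ≤ _root_.lpNorm p f :=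
  Real.rpow_nonneg (integral_nonneg fun _ => Real.rpow_nonneg (abs_nonneg _) _) _

lemma lpNorm_rpow {d : ℕ} {p : ℝ} (hp : 0 < p) (f : (Fin d → ℝ) → ℝ) :
    _root_.lpNorm p f ^ p = ∫ x, |f x| ^ p := by
  rw [_root_.lpNorm, ← Real.rpow_mul (integral_nonneg fun _ => Real.rpow_nonneg (abs_nonneg _) _),
    one_div_mul_cancel hp.ne', Real.rpow_one]

lemma lpNorm_sub_le {d : ℕ} {p : ℝ} (hp : 1 ≤ p) {f g : (Fin d → ℝ) → ℝ}
    (hf : MemLp f (ENNReal.ofReal p) volume) (hg : MemLp g (ENNReal.ofReal p) volume) :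
    _root_.lpNorm p (f - g) ≤ _root_.lpNorm p f + _root_.lpNorm p g := by
  have hp0 : 0 < p := by linarith
  rw [lpNorm_eq_toReal_eLpNorm hp0 hf, lpNorm_eq_toReal_eLpNorm hp0 hg,
    lpNorm_eq_toReal_eLpNorm hp0 (hf.sub hg),
    ← ENNReal.toReal_add hf.eLpNorm_ne_top hg.eLpNorm_ne_top]
  exact ENNReal.toReal_mono (by simp [hf.eLpNorm_ne_top, hg.eLpNorm_ne_top])
    (eLpNorm_sub_le hf.1 hg.1 (by simpa using hp))

lemma lpNorm_neg {d : ℕ} (p : ℝ) (f : (Fin d → ℝ) → ℝ) :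
    _root_.lpNorm p (-f) = _root_.lpNorm p f := by
  simp [_root_.lpNorm]

lemma lpNorm_add_le {d : ℕ} {p : ℝ} (hp : 1 ≤ p) {f g : (Fin d → ℝ) → ℝ}
    (hf : MemLp f (ENNReal.ofReal p) volume) (hg : MemLp g (ENNReal.ofReal p) volume) :
    _root_.lpNorm p (f + g) ≤ _root_.lpNorm p f + _root_.lpNorm p g := by
  simpa [lpNorm_neg] using lpNorm_sub_le hp hf hg.neg

lemma abs_lpNorm_sub_lpNorm_le {d : ℕ} {p : ℝ} (hp : 1 ≤ p) {f g : (Fin d → ℝ) → ℝ}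
    (hf : MemLp f (ENNReal.ofReal p) volume) (hg : MemLp g (ENNReal.ofReal p) volume) :
    |_root_.lpNorm p f - _root_.lpNorm p g| ≤ _root_.lpNorm p (f - g) := by
  have h1 := lpNorm_add_le hp (hf.sub hg) hg
  have h2 := lpNorm_sub_le hp hf (hf.sub hg)
  rw [sub_add_cancel] at h1
  rw [sub_sub_cancel] at h2
  exact abs_le.2 ⟨by linarith, by linarith⟩

lemma lpNorm_sum_le {d : ℕ} {p : ℝ} (hp : 1 ≤ p) {ι : Type*} (s : Finset ι)
    {f : ι → (Fin d → ℝ) → ℝ} (hf : ∀ i, MemLp (f i) (ENNReal.ofReal p) volume) :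
    _root_.lpNorm p (∑ i ∈ s, f i) ≤ ∑ i ∈ s, _root_.lpNorm p (f i) := by
  classical
  induction s using Finset.induction_on with
  | empty =>
    simp [_root_.lpNorm, Real.zero_rpow (by linarith : p ≠ 0)]
    simp [Real.zero_rpow (by positivity : p⁻¹ ≠ 0)]
  | insert a s ha ih =>
    rw [Finset.sum_insert ha, Finset.sum_insert ha]
    exact (lpNorm_add_le hp (hf a) (memLp_finsetSum' s fun i _ => hf i)).trans (by gcongr)

lemma integrable_rpow_abs {d : ℕ} {p : ℝ} (hp : 0 < p) {f : (Fin d → ℝ) → ℝ}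
    (hf : MemLp f (ENNReal.ofReal p) volume) : Integrable fun x => |f x| ^ p := by
  have := hf.integrable_norm_rpow (by simpa using hp) ENNReal.ofReal_ne_top
  rwa [ENNReal.toReal_ofReal hp.le] at this

lemma integrable_prod_rpow_abs {Ω : Type*} [MeasurableSpace Ω] (P : Measure Ω)
    [IsProbabilityMeasure P] {d : ℕ} {p c : ℝ} (hp : 0 < p)
    {S : Ω → (Fin d → ℝ) → ℝ} (hS : Measurable (Function.uncurry S))
    (hmem : ∀ ω, MemLp (S ω) (ENNReal.ofReal p) volume) (hc : ∀ ω, _root_.lpNorm p (S ω) ≤ c) :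
    Integrable (fun q : Ω × (Fin d → ℝ) => |S q.1 q.2| ^ p) (P.prod volume) := by
  have hm : Measurable fun q : Ω × (Fin d → ℝ) => |S q.1 q.2| ^ p :=
    (continuous_abs.measurable.comp hS).pow_const p
  rw [integrable_prod_iff hm.aestronglyMeasurable]
  refine ⟨Eventually.of_forall fun ω => integrable_rpow_abs hp (hmem ω), ?_⟩
  refine Integrable.of_bound (C := c ^ p)
    (StronglyMeasurable.integral_prod_right' hm.norm.stronglyMeasurable).aestronglyMeasurable
    (Eventually.of_forall fun ω => ?_)
  have : ∀ x, ‖|S ω x| ^ p‖ = |S ω x| ^ p := fun x => by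
    rw [Real.norm_eq_abs, abs_of_nonneg (by positivity)]
  simp only [this]
  rw [← lpNorm_rpow hp, Real.norm_eq_abs, abs_of_nonneg (Real.rpow_nonneg (lpNorm_nonneg _ _) _)]
  exact Real.rpow_le_rpow (lpNorm_nonneg _ _) (hc ω) hp.le

lemma measurable_lpNorm {Ω : Type*} [MeasurableSpace Ω] {d : ℕ} (p : ℝ)
    {S : Ω → (Fin d → ℝ) → ℝ} (hS : Measurable (Function.uncurry S)) :
    Measurable fun ω => _root_.lpNorm p (S ω) := by
  have hm : Measurable fun q : Ω × (Fin d → ℝ) => |S q.1 q.2| ^ p :=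
    (continuous_abs.measurable.comp hS).pow_const p
  exact (StronglyMeasurable.integral_prod_right' hm.stronglyMeasurable).measurable.pow_const _

lemma lpNorm_empirical_sum_le {E : Type*} {d : ℕ} {p c : ℝ} {Y : E → (Fin d → ℝ) → ℝ}
    (hp : 1 ≤ p) (hmem : ∀ z, MemLp (Y z) (ENNReal.ofReal p) volume)
    (hc : ∀ z, _root_.lpNorm p (Y z) ≤ c) (n : ℕ) (ω : Fin n → E) :
    _root_.lpNorm p (∑ i, Y (ω i)) ≤ n * c :=
  (lpNorm_sum_le hp _ fun i => hmem (ω i)).trans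
    ((Finset.sum_le_sum fun i _ => hc (ω i)).trans (by simp))

section EmpiricalSum

variable {E : Type*} [MeasurableSpace E] (μ : Measure E) [IsProbabilityMeasure μ] {d : ℕ}
  {p c B : ℝ} {Y : E → (Fin d → ℝ) → ℝ}

lemma measurable_empirical_sum (hY : Measurable (Function.uncurry Y)) (n : ℕ) :
    Measurable (Function.uncurry fun ω : Fin n → E => ∑ i, Y (ω i)) := by
  have : (Function.uncurry fun ω : Fin n → E => ∑ i, Y (ω i))
      = fun q => ∑ i, Function.uncurry Y (q.1 i, q.2) := by
    ext q
    simp [Function.uncurry]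
  rw [this]
  exact Finset.measurable_sum _ fun i _ =>
    hY.comp (((measurable_pi_apply i).comp measurable_fst).prodMk measurable_snd)

/-- The mean of the `L_p` norm of a sum of `n` centred i.i.d. random functions. -/
lemma integral_lpNorm_empirical_sum_le (hp : 1 ≤ p) (hp2 : p ≤ 2)
    (hY : Measurable (Function.uncurry Y)) (hB : ∀ z x, |Y z x| ≤ B)
    (hmem : ∀ z, MemLp (Y z) (ENNReal.ofReal p) volume) (hc : ∀ z, _root_.lpNorm p (Y z) ≤ c)
    (h0 : ∀ x, ∫ z, Y z x ∂μ = 0) (n : ℕ) :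
    ∫ ω, _root_.lpNorm p (∑ i, Y (ω i)) ∂(Measure.pi fun _ : Fin n => μ)
      ≤ (4 * n) ^ (1 / p) * c := by
  have hp0 : 0 < p := by linarith
  obtain ⟨z₀⟩ : Nonempty E := μ.nonempty_of_neZero
  have hc0 : 0 ≤ c := (lpNorm_nonneg p _).trans (hc z₀)
  set P := Measure.pi fun _ : Fin n => μ with hP
  set Z : (Fin n → E) → ℝ := fun ω => _root_.lpNorm p (∑ i, Y (ω i)) with hZ
  have hZ0 : ∀ ω, 0 ≤ Z ω := fun ω => lpNorm_nonneg _ _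
  have hZB : ∀ ω, Z ω ≤ n * c := lpNorm_empirical_sum_le hp hmem hc n
  have hSm := measurable_empirical_sum hY n
  have hZm : Measurable Z := measurable_lpNorm p hSm
  have hSmem : ∀ ω : Fin n → E, MemLp (∑ i, Y (ω i)) (ENNReal.ofReal p) volume := fun ω =>
    memLp_finsetSum' _ fun i _ => hmem (ω i)
  have hZint : Integrable Z P := Integrable.of_bound (C := n * c) hZm.aestronglyMeasurable
    (Eventually.of_forall fun ω => by rw [Real.norm_eq_abs, abs_of_nonneg (hZ0 ω)]; exact hZB ω)
  have hZpint : Integrable (fun ω => Z ω ^ p) P :=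
    Integrable.of_bound (C := (n * c) ^ p) (hZm.pow_const p).aestronglyMeasurable
      (Eventually.of_forall fun ω => by
        rw [Real.norm_eq_abs, abs_of_nonneg (Real.rpow_nonneg (hZ0 ω) _)]
        exact Real.rpow_le_rpow (hZ0 ω) (hZB ω) hp0.le)
  have hjensen : (∫ ω, Z ω ∂P) ^ p ≤ ∫ ω, Z ω ^ p ∂P :=
    (convexOn_rpow hp).map_integral_le (Real.continuous_rpow_const hp0.le).continuousOn
      isClosed_Ici (Eventually.of_forall hZ0) hZint hZpint
  have hSprod := integrable_prod_rpow_abs P hp0 hSm hSmem hZB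
  have hYprod := integrable_prod_rpow_abs μ hp0 hY hmem hc
  have hpow : ∫ ω, Z ω ^ p ∂P ≤ 4 * n * c ^ p := by
    simp only [hZ, lpNorm_rpow hp0]
    rw [integral_integral_swap hSprod]
    calc _ ≤ ∫ x, n * (4 * ∫ z, |Y z x| ^ p ∂μ) := by
          refine integral_mono hSprod.integral_prod_right
            ((hYprod.integral_prod_right.const_mul _).const_mul _) fun x => ?_
          simpa using integral_rpow_abs_sum_le μ hp hp2 (y := fun z => Y z x)
            (hY.comp measurable_prodMk_right) (fun z => hB z x) (h0 x) n
      _ = n * (4 * ∫ z, _root_.lpNorm p (Y z) ^ p ∂μ) := by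
          rw [integral_const_mul, integral_const_mul, ← integral_integral_swap hYprod]
          simp only [lpNorm_rpow hp0]
      _ ≤ n * (4 * c ^ p) := by
          gcongr
          have := integral_mono_of_nonneg (μ := μ)
            (Eventually.of_forall fun z => Real.rpow_nonneg (lpNorm_nonneg p (Y z)) p)
            (integrable_const (c ^ p)) (Eventually.of_forall fun z =>
              Real.rpow_le_rpow (lpNorm_nonneg p (Y z)) (hc z) hp0.le)
          simpa using this
      _ = _ := by ring
  have hroot : (4 * n * c ^ p) = ((4 * n) ^ (1 / p) * c) ^ p := by
    rw [Real.mul_rpow (by positivity) hc0, ← Real.rpow_mul (by positivity),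
      one_div_mul_cancel hp0.ne', Real.rpow_one]
  rw [hroot] at hpow
  exact (Real.rpow_le_rpow_iff (integral_nonneg hZ0) (by positivity) hp0).1 (hjensen.trans hpow)

lemma integrable_exp_lpNorm_empirical_sum (hp : 1 ≤ p) (hY : Measurable (Function.uncurry Y))
    (hmem : ∀ z, MemLp (Y z) (ENNReal.ofReal p) volume) (hc : ∀ z, _root_.lpNorm p (Y z) ≤ c)
    (n : ℕ) {t : ℝ} (ht : 0 ≤ t) (τ : ℝ) :
    Integrable (fun ω => Real.exp (t * (_root_.lpNorm p (∑ i, Y (ω i)) - τ)))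
      (Measure.pi fun _ : Fin n => μ) := by
  have hZm : Measurable fun ω : Fin n → E => _root_.lpNorm p (∑ i, Y (ω i)) :=
    measurable_lpNorm p (measurable_empirical_sum hY n)
  refine Integrable.of_bound (C := Real.exp (t * (n * c - τ)))
    (by fun_prop : Measurable _).aestronglyMeasurable (Eventually.of_forall fun ω => ?_)
  rw [Real.norm_eq_abs, Real.abs_exp]
  gcongr
  exact lpNorm_empirical_sum_le hp hmem hc n ω

/-- Exponential deviation bound for the `L_p` norm of a sum of centred i.i.d. random functions. -/
lemma integral_exp_lpNorm_empirical_sum_le (hp : 1 ≤ p) (hp2 : p ≤ 2)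
    (hY : Measurable (Function.uncurry Y)) (hB : ∀ z x, |Y z x| ≤ B)
    (hmem : ∀ z, MemLp (Y z) (ENNReal.ofReal p) volume) (hc : ∀ z, _root_.lpNorm p (Y z) ≤ c)
    (h0 : ∀ x, ∫ z, Y z x ∂μ = 0) (n : ℕ) {t : ℝ} (ht : 0 ≤ t) (τ : ℝ) :
    ∫ ω, Real.exp (t * (_root_.lpNorm p (∑ i, Y (ω i)) - τ)) ∂(Measure.pi fun _ : Fin n => μ)
      ≤ Real.exp (n * ((2 * c) ^ 2 * t ^ 2 / 2) + t * ((4 * n) ^ (1 / p) * c - τ)) := by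
  set P := Measure.pi fun _ : Fin n => μ with hP
  set Z : (Fin n → E) → ℝ := fun ω => _root_.lpNorm p (∑ i, Y (ω i)) with hZ
  have hmgf := bounded_difference_mgf μ (c := 2 * c) t n (F := Z) (B := n * c)
    (measurable_lpNorm p (measurable_empirical_sum hY n))
    (fun ω => by
      rw [abs_of_nonneg (lpNorm_nonneg _ _)]
      exact lpNorm_empirical_sum_le hp hmem hc n ω)
    (fun ω ω' i hij => by
      refine (abs_lpNorm_sub_lpNorm_le hp (memLp_finsetSum' _ fun i _ => hmem (ω i))
        (memLp_finsetSum' _ fun i _ => hmem (ω' i))).trans ?_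
      rw [← Finset.sum_sub_distrib, Finset.sum_eq_single i
        (fun j _ hj => by rw [hij j hj, sub_self]) (by simp)]
      have := lpNorm_sub_le hp (hmem (ω i)) (hmem (ω' i))
      linarith [hc (ω i), hc (ω' i)])
  have hmean := integral_lpNorm_empirical_sum_le μ hp hp2 hY hB hmem hc h0 n
  have hsplit : ∀ ω, Real.exp (t * (Z ω - τ))
      = Real.exp (t * (Z ω - ∫ η, Z η ∂P)) * Real.exp (t * (∫ η, Z η ∂P - τ)) := fun ω => by
    rw [← Real.exp_add]; ring_nf
  calc _ = (∫ ω, Real.exp (t * (Z ω - ∫ η, Z η ∂P)) ∂P) * Real.exp (t * (∫ η, Z η ∂P - τ)) := by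
        rw [← integral_mul_const]
        exact integral_congr_ae (Eventually.of_forall hsplit)
    _ ≤ Real.exp (n * ((2 * c) ^ 2 * t ^ 2 / 2))
          * Real.exp (t * ((4 * n) ^ (1 / p) * c - τ)) := by
        gcongr
    _ = _ := by rw [← Real.exp_add]

end EmpiricalSum

lemma memLp_of_integrable_rpow_abs {d : ℕ} {p : ℝ} (hp : 0 < p) {f : (Fin d → ℝ) → ℝ}
    (hf : AEStronglyMeasurable f volume) (h : Integrable fun x => |f x| ^ p) :
    MemLp f (ENNReal.ofReal p) volume := by
  rw [← integrable_norm_rpow_iff hf (by simpa using hp) ENNReal.ofReal_ne_top,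
    ENNReal.toReal_ofReal hp.le]
  exact h

lemma memLp_of_integrable_of_bounded {d : ℕ} {p : ℝ} (hp : 1 ≤ p) {f : (Fin d → ℝ) → ℝ}
    (hf : Integrable f) {C : ℝ} (hC : ∀ x, |f x| ≤ C) : MemLp f (ENNReal.ofReal p) volume := by
  have hp0 : 0 < p := by linarith
  have hm : AEStronglyMeasurable (fun x => |f x| ^ p) volume :=
    (hf.1.norm.aemeasurable.pow_const p).aestronglyMeasurable
  refine memLp_of_integrable_rpow_abs hp0 hf.1 ((hf.norm.const_mul (C ^ (p - 1))).mono' hm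
    (Eventually.of_forall fun x => ?_))
  rw [Real.norm_eq_abs, abs_of_nonneg (by positivity), Real.norm_eq_abs]
  rcases eq_or_ne (f x) 0 with h | h
  · simp [h, hp0.ne']
  · rw [← sub_add_cancel p 1, Real.rpow_add_one (abs_pos.2 h).ne', sub_add_cancel]
    exact mul_le_mul_of_nonneg_right
      (Real.rpow_le_rpow (abs_nonneg _) (hC x) (by linarith)) (abs_nonneg _)

section Scaling

variable {d : ℕ} {h : Fin d → ℝ}

lemma map_div_volume (hh : ∀ j, 0 < h j) :
    Measure.map (fun (x : Fin d → ℝ) j => x j / h j) volume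
      = ENNReal.ofReal (∏ j, h j) • volume := by
  have hV : 0 < ∏ j, h j := Finset.prod_pos fun j _ => hh j
  have hdet : Matrix.det (Matrix.diagonal fun j => (h j)⁻¹) = (∏ j, h j)⁻¹ := by
    rw [Matrix.det_diagonal, Finset.prod_inv_distrib]
  have := Real.smul_map_diagonal_volume_pi (D := fun j => (h j)⁻¹)
    (by rw [hdet]; positivity)
  rw [hdet, abs_of_pos (by positivity)] at this
  have hfun : (fun (x : Fin d → ℝ) j => x j / h j)
      = Matrix.toLin' (Matrix.diagonal fun j => (h j)⁻¹) := by
    ext x j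
    simp [Matrix.mulVec_diagonal, div_eq_inv_mul]
  rw [hfun]
  conv_rhs => rw [← this]
  rw [smul_smul, ← ENNReal.ofReal_mul hV.le, mul_inv_cancel₀ hV.ne', ENNReal.ofReal_one, one_smul]

lemma measurable_div_pi : Measurable fun (x : Fin d → ℝ) j => x j / h j := by fun_prop

lemma integral_comp_div (hh : ∀ j, 0 < h j) {f : (Fin d → ℝ) → ℝ} (hf : Measurable f) :
    ∫ x : Fin d → ℝ, f (fun j => x j / h j) = (∏ j, h j) * ∫ x, f x := by
  have hV : 0 < ∏ j, h j := Finset.prod_pos fun j _ => hh j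
  rw [← integral_map measurable_div_pi.aemeasurable hf.aestronglyMeasurable, map_div_volume hh,
    integral_smul_measure, ENNReal.toReal_ofReal hV.le, smul_eq_mul]

lemma integrable_comp_div (hh : ∀ j, 0 < h j) {f : (Fin d → ℝ) → ℝ} (hf : Measurable f)
    (hfi : Integrable f) : Integrable fun x : Fin d → ℝ => f (fun j => x j / h j) := by
  have := (integrable_map_measure (μ := (volume : Measure (Fin d → ℝ)))
    (f := fun (x : Fin d → ℝ) j => x j / h j) hf.aestronglyMeasurable
    measurable_div_pi.aemeasurable).1
    (by rw [map_div_volume hh]; exact hfi.smul_measure ENNReal.ofReal_ne_top)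
  exact this

variable {K : (Fin d → ℝ) → ℝ}

lemma measurable_scaledKernel (hK : Measurable K) : Measurable (scaledKernel K h) :=
  (hK.comp measurable_div_pi).const_mul _

lemma memLp_scaledKernel {p : ℝ} (hp : 1 ≤ p) (hK : IsGoodKernel K) (hh : ∀ j, 0 < h j) :
    MemLp (scaledKernel K h) (ENNReal.ofReal p) volume := by
  obtain ⟨hKc, ⟨C, hC⟩, -, hKi, -⟩ := hK
  exact (memLp_of_integrable_of_bounded hp (integrable_comp_div hh hKc.measurable hKi)
    fun x => hC _).const_mul _

lemma lpNorm_scaledKernel {p : ℝ} (hp : 1 ≤ p) (hK : IsGoodKernel K) (hh : ∀ j, 0 < h j) :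
    _root_.lpNorm p (scaledKernel K h) = _root_.lpNorm p K * (∏ j, h j) ^ (1 / p - 1) := by
  have hp0 : 0 < p := by linarith
  have hV : 0 < ∏ j, h j := Finset.prod_pos fun j _ => hh j
  have hI : 0 ≤ ∫ x, |K x| ^ p := integral_nonneg fun x => by positivity
  have : ∫ x, |scaledKernel K h x| ^ p = (∏ j, h j) ^ (1 - p) * ∫ x, |K x| ^ p := by
    simp only [scaledKernel, abs_mul]
    simp_rw [fun x => Real.mul_rpow (abs_nonneg (∏ j, h j)⁻¹) (abs_nonneg (K x)) (z := p)]
    rw [integral_const_mul, integral_comp_div hh (f := fun x => |K x| ^ p)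
      (hK.1.measurable.abs.pow_const p), abs_of_pos (by positivity), ← mul_assoc,
      Real.inv_rpow hV.le, ← Real.rpow_neg hV.le, ← Real.rpow_add_one hV.ne']
    ring_nf
  rw [_root_.lpNorm, this, Real.mul_rpow (by positivity) hI, ← Real.rpow_mul hV.le, _root_.lpNorm,
    mul_comm]
  congr 2
  field_simp

end Scaling

lemma lpNorm_const_mul {d : ℕ} {p : ℝ} (hp : 0 < p) {a : ℝ} (ha : 0 ≤ a) (f : (Fin d → ℝ) → ℝ) :
    _root_.lpNorm p (fun x => a * f x) = a * _root_.lpNorm p f := by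
  have hI : 0 ≤ ∫ x, |f x| ^ p := integral_nonneg fun x => by positivity
  simp only [_root_.lpNorm, abs_mul, abs_of_nonneg ha]
  simp_rw [fun x => Real.mul_rpow ha (abs_nonneg (f x)) (z := p)]
  rw [integral_const_mul, Real.mul_rpow (by positivity) hI, ← Real.rpow_mul ha,
    mul_one_div_cancel hp.ne', Real.rpow_one]

section Convolution

variable {d : ℕ} {p : ℝ} {k : (Fin d → ℝ) → ℝ}

lemma lpNorm_comp_sub_left (z : Fin d → ℝ) :
    _root_.lpNorm p (fun x => k (z - x)) = _root_.lpNorm p k := by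
  rw [_root_.lpNorm, _root_.lpNorm, integral_sub_left_eq_self (fun x => |k x| ^ p)]

lemma memLp_comp_sub_left (hk : MemLp k (ENNReal.ofReal p) volume) (z : Fin d → ℝ) :
    MemLp (fun x => k (z - x)) (ENNReal.ofReal p) volume :=
  hk.comp_measurePreserving (Measure.measurePreserving_sub_left volume z)

lemma convolution_bounds (μ : Measure (Fin d → ℝ)) [IsProbabilityMeasure μ] (hp : 1 ≤ p)
    (hk : Measurable k) {C : ℝ} (hC : ∀ x, |k x| ≤ C)
    (hmem : MemLp k (ENNReal.ofReal p) volume) :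
    MemLp (fun x => ∫ w, k (w - x) ∂μ) (ENNReal.ofReal p) volume ∧
      _root_.lpNorm p (fun x => ∫ w, k (w - x) ∂μ) ≤ _root_.lpNorm p k := by
  have hp0 : 0 < p := by linarith
  set S : (Fin d → ℝ) → (Fin d → ℝ) → ℝ := fun w x => k (w - x) with hSdef
  have hS : Measurable (Function.uncurry S) := hk.comp (measurable_fst.sub measurable_snd)
  have hprod := integrable_prod_rpow_abs μ hp0 hS (memLp_comp_sub_left hmem)
    (fun z => (lpNorm_comp_sub_left z).le)
  have hSi : ∀ x, Integrable (fun w => S w x) μ := fun x =>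
    Integrable.of_bound (C := C) (hS.comp measurable_prodMk_right).aestronglyMeasurable
      (Eventually.of_forall fun w => hC _)
  have hmean : Measurable fun x => ∫ w, k (w - x) ∂μ :=
    (StronglyMeasurable.integral_prod_left'
      (f := fun q : (Fin d → ℝ) × (Fin d → ℝ) => k (q.1 - q.2)) hS.stronglyMeasurable).measurable
  have hjensen : ∀ x, |∫ w, k (w - x) ∂μ| ^ p ≤ ∫ w, |k (w - x)| ^ p ∂μ := fun x => by
    refine (Real.rpow_le_rpow (abs_nonneg _) abs_integral_le_integral_abs hp0.le).trans ?_
    refine (convexOn_rpow hp).map_integral_le (Real.continuous_rpow_const hp0.le).continuousOn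
      isClosed_Ici (Eventually.of_forall fun w => Set.mem_Ici.2 (abs_nonneg _)) (hSi x).abs ?_
    refine Integrable.of_bound (C := C ^ p)
      (((hS.comp measurable_prodMk_right).abs).pow_const p).aestronglyMeasurable
      (Eventually.of_forall fun w => ?_)
    simp only [Function.comp_apply]
    rw [Real.norm_eq_abs, abs_of_nonneg (by positivity)]
    exact Real.rpow_le_rpow (abs_nonneg _) (hC _) hp0.le
  have hmeani : Integrable fun x => |∫ w, k (w - x) ∂μ| ^ p :=
    hprod.integral_prod_right.mono' (hmean.abs.pow_const p).aestronglyMeasurable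
      (Eventually.of_forall fun x => by
        rw [Real.norm_eq_abs, abs_of_nonneg (by positivity)]
        exact hjensen x)
  refine ⟨memLp_of_integrable_rpow_abs hp0 hmean.aestronglyMeasurable hmeani, ?_⟩
  refine (Real.rpow_le_rpow_iff (lpNorm_nonneg _ _) (lpNorm_nonneg _ _) hp0).1 ?_
  rw [lpNorm_rpow hp0]
  calc _ ≤ ∫ x, ∫ w, |k (w - x)| ^ p ∂μ := integral_mono hmeani hprod.integral_prod_right hjensen
    _ = ∫ w, _root_.lpNorm p (fun x => k (w - x)) ^ p ∂μ := by
        rw [← integral_integral_swap hprod]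
        simp only [lpNorm_rpow hp0]
    _ = _ := by simp [lpNorm_comp_sub_left]

end Convolution

lemma IsDensity.isProbabilityMeasure {d : ℕ} {𝔭 : (Fin d → ℝ) → ℝ} (h𝔭 : IsDensity 𝔭) :
    IsProbabilityMeasure (densMeasure 𝔭) := by
  refine ⟨?_⟩
  rw [densMeasure, withDensity_apply _ MeasurableSet.univ, Measure.restrict_univ,
    ← ofReal_integral_eq_lintegral_ofReal h𝔭.2.1 (Eventually.of_forall h𝔭.1), h𝔭.2.2,
    ENNReal.ofReal_one]

lemma IsDensity.integral_densMeasure {d : ℕ} {𝔭 : (Fin d → ℝ) → ℝ} (h𝔭 : IsDensity 𝔭)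
    (f : (Fin d → ℝ) → ℝ) : ∫ z, f z ∂(densMeasure 𝔭) = ∫ z, f z * 𝔭 z := by
  rw [densMeasure,
    integral_withDensity_eq_integral_toReal_smul₀ h𝔭.2.1.1.aemeasurable.ennreal_ofReal
    (Eventually.of_forall fun _ => ENNReal.ofReal_lt_top)]
  simp only [ENNReal.toReal_ofReal (h𝔭.1 _), smul_eq_mul, mul_comm]

lemma IsGoodKernel.lpNorm_pos {d : ℕ} {K : (Fin d → ℝ) → ℝ} (hK : IsGoodKernel K)
    {p : ℝ} (hp : 1 ≤ p) : 0 < _root_.lpNorm p K := by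
  have hp0 : 0 < p := by linarith
  obtain ⟨hKc, ⟨C, hC⟩, -, hKi, hK1⟩ := hK
  have hmem := memLp_of_integrable_of_bounded hp hKi hC
  refine lt_of_le_of_ne (lpNorm_nonneg _ _) fun h0 => ?_
  rw [lpNorm_eq_toReal_eLpNorm hp0 hmem, eq_comm, ENNReal.toReal_eq_zero_iff,
    or_iff_left hmem.eLpNorm_ne_top, eLpNorm_eq_zero_iff hmem.1 (by simpa using hp0)] at h0
  rw [integral_congr_ae h0] at hK1
  simp at hK1

section EmpiricalProcess

variable {d : ℕ} {K : (Fin d → ℝ) → ℝ} {p : ℝ} {𝔭 : (Fin d → ℝ) → ℝ} {h : Fin d → ℝ}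

/-- The contribution of one observation `z` to the empirical process. -/
def empSummand {d : ℕ} (K : (Fin d → ℝ) → ℝ) (𝔭 : (Fin d → ℝ) → ℝ) (m : ℕ)
    (h z x : Fin d → ℝ) : ℝ :=
  (m : ℝ)⁻¹ * (scaledKernel K h (z - x) - ∫ w, scaledKernel K h (w - x) ∂(densMeasure 𝔭))

lemma empProc_eq_sum (h𝔭 : IsDensity 𝔭) (m : ℕ) (ω : Fin m → Fin d → ℝ) :
    (fun x => empProc K 𝔭 m ω x h) = ∑ i, empSummand K 𝔭 m h (ω i) := by
  ext x
  simp only [empProc, empSummand, Finset.sum_apply, h𝔭.integral_densMeasure, Finset.mul_sum]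

lemma measurable_empSummand (hK : IsGoodKernel K) (h𝔭 : IsDensity 𝔭) (m : ℕ) :
    Measurable (Function.uncurry (empSummand K 𝔭 m h)) := by
  have := h𝔭.isProbabilityMeasure
  have hS : Measurable fun q : (Fin d → ℝ) × (Fin d → ℝ) => scaledKernel K h (q.1 - q.2) :=
    (measurable_scaledKernel hK.1.measurable).comp (measurable_fst.sub measurable_snd)
  have hmean : Measurable fun x => ∫ w, scaledKernel K h (w - x) ∂(densMeasure 𝔭) :=
    (StronglyMeasurable.integral_prod_left' hS.stronglyMeasurable).measurable
  exact (hS.sub (hmean.comp measurable_snd)).const_mul _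

lemma exists_scaledKernel_bound (hK : IsGoodKernel K) :
    ∃ C, ∀ x, |scaledKernel K h x| ≤ C := by
  obtain ⟨C, hC⟩ := hK.2.1
  refine ⟨|(∏ j, h j)⁻¹| * C, fun x => ?_⟩
  rw [scaledKernel, abs_mul]
  exact mul_le_mul_of_nonneg_left (hC _) (abs_nonneg _)

lemma exists_empSummand_bound (hK : IsGoodKernel K) (h𝔭 : IsDensity 𝔭) (m : ℕ) :
    ∃ B, ∀ z x, |empSummand K 𝔭 m h z x| ≤ B := by
  have := h𝔭.isProbabilityMeasure
  obtain ⟨C, hC⟩ := exists_scaledKernel_bound (h := h) hK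
  refine ⟨|(m : ℝ)⁻¹| * (C + C), fun z x => ?_⟩
  rw [empSummand, abs_mul]
  refine mul_le_mul_of_nonneg_left ((abs_sub _ _).trans (add_le_add (hC _) ?_)) (abs_nonneg _)
  simpa using norm_integral_le_of_norm_le_const (μ := densMeasure 𝔭)
    (f := fun w => scaledKernel K h (w - x)) (Eventually.of_forall fun w => hC (w - x))

lemma integral_empSummand (hK : IsGoodKernel K) (h𝔭 : IsDensity 𝔭) (m : ℕ) (x : Fin d → ℝ) :
    ∫ z, empSummand K 𝔭 m h z x ∂(densMeasure 𝔭) = 0 := by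
  have := h𝔭.isProbabilityMeasure
  obtain ⟨C, hC⟩ := exists_scaledKernel_bound (h := h) hK
  have hi : Integrable (fun z => scaledKernel K h (z - x)) (densMeasure 𝔭) :=
    Integrable.of_bound (C := C) ((measurable_scaledKernel hK.1.measurable).comp
      (measurable_id.sub_const x)).aestronglyMeasurable (Eventually.of_forall fun w => hC _)
  simp only [empSummand]
  rw [integral_const_mul, integral_sub hi (integrable_const _)]
  simp

lemma lpNorm_empSummand_le (hK : IsGoodKernel K) (h𝔭 : IsDensity 𝔭) (hp : 1 ≤ p)
    (hh : ∀ j, 0 < h j) (m : ℕ) (z : Fin d → ℝ) :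
    MemLp (empSummand K 𝔭 m h z) (ENNReal.ofReal p) volume ∧
      _root_.lpNorm p (empSummand K 𝔭 m h z)
        ≤ (m : ℝ)⁻¹ * (2 * (_root_.lpNorm p K * (∏ j, h j) ^ (1 / p - 1))) := by
  have := h𝔭.isProbabilityMeasure
  obtain ⟨C, hC⟩ := exists_scaledKernel_bound (h := h) hK
  have hmem := memLp_scaledKernel hp hK hh
  obtain ⟨h1, h2⟩ := convolution_bounds (densMeasure 𝔭) hp
    (measurable_scaledKernel hK.1.measurable) hC hmem
  have h3 := memLp_comp_sub_left hmem z
  refine ⟨(h3.sub h1).const_mul _, ?_⟩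
  have h4 := lpNorm_const_mul (by linarith : 0 < p) (a := (m : ℝ)⁻¹) (by positivity)
    ((fun x => scaledKernel K h (z - x)) - fun x => ∫ w, scaledKernel K h (w - x) ∂(densMeasure 𝔭))
  refine (le_of_eq h4).trans (mul_le_mul_of_nonneg_left ?_ (by positivity))
  have h5 := lpNorm_sub_le hp h3 h1
  rw [lpNorm_comp_sub_left] at h5
  rw [lpNorm_scaledKernel hp hK hh] at h5 h2
  linarith

lemma lpNorm_empProc_le (hK : IsGoodKernel K) (h𝔭 : IsDensity 𝔭) (hp : 1 ≤ p)
    (hh : ∀ j, 0 < h j) {m : ℕ} (hm : 1 ≤ m) (ω : Fin m → Fin d → ℝ) :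
    _root_.lpNorm p (fun x => empProc K 𝔭 m ω x h)
      ≤ 2 * (_root_.lpNorm p K * (∏ j, h j) ^ (1 / p - 1)) := by
  have hm0 : (m : ℝ) ≠ 0 := by positivity
  rw [empProc_eq_sum h𝔭]
  refine (lpNorm_empirical_sum_le hp (fun z => (lpNorm_empSummand_le hK h𝔭 hp hh m z).1)
    (fun z => (lpNorm_empSummand_le hK h𝔭 hp hh m z).2) m ω).trans (le_of_eq ?_)
  rw [mul_inv_cancel_left₀ hm0]

lemma integrable_exp_lpNorm_empProc (hK : IsGoodKernel K) (h𝔭 : IsDensity 𝔭) (hp : 1 ≤ p)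
    (hh : ∀ j, 0 < h j) (m : ℕ) {t : ℝ} (ht : 0 ≤ t) (τ : ℝ) :
    Integrable (fun ω => Real.exp (t * (_root_.lpNorm p (fun x => empProc K 𝔭 m ω x h) - τ)))
      (sampleMeasure 𝔭 m) := by
  have := h𝔭.isProbabilityMeasure
  simp only [empProc_eq_sum h𝔭]
  exact integrable_exp_lpNorm_empirical_sum _ hp (measurable_empSummand hK h𝔭 m)
    (fun z => (lpNorm_empSummand_le hK h𝔭 hp hh m z).1)
    (fun z => (lpNorm_empSummand_le hK h𝔭 hp hh m z).2) m ht τ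

/-- The exponential moment at the scale `(A / m ^ (2 / p - 1))⁻¹`, where
`A = ‖K‖_p (m V_h) ^ (1 / p - 1)`. -/
lemma integral_exp_lpNorm_empProc_le (hK : IsGoodKernel K) (h𝔭 : IsDensity 𝔭) (hp : 1 ≤ p)
    (hp2 : p ≤ 2) (hh : ∀ j, 0 < h j) {m : ℕ} (hm : 1 ≤ m) {A L : ℝ}
    (hA : A = _root_.lpNorm p K * ((m : ℝ) * ∏ j, h j) ^ (1 / p - 1))
    (hL : L = (m : ℝ) ^ (2 / p - 1)) :
    ∫ ω, Real.exp (L / A * (_root_.lpNorm p (fun x => empProc K 𝔭 m ω x h) - 128 * A))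
      ∂(sampleMeasure 𝔭 m) ≤ Real.exp (-L) := by
  have := h𝔭.isProbabilityMeasure
  have hp0 : 0 < p := by linarith
  have hm0 : (0 : ℝ) < m := by positivity
  have hV : 0 < ∏ j, h j := Finset.prod_pos fun j _ => hh j
  have hKp : 0 < _root_.lpNorm p K := hK.lpNorm_pos hp
  have hA0 : 0 < A := by rw [hA]; positivity
  have hL0 : 0 < L := by rw [hL]; positivity
  obtain ⟨B, hB⟩ := exists_empSummand_bound (h := h) hK h𝔭 m
  set c := (m : ℝ)⁻¹ * (2 * (_root_.lpNorm p K * (∏ j, h j) ^ (1 / p - 1))) with hc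
  have hcA : (m : ℝ) ^ (1 / p) * c = 2 * A := by
    rw [hc, hA, Real.mul_rpow hm0.le hV.le, Real.rpow_sub_one hm0.ne']
    field_simp
  have hmL : (m : ℝ) ^ (1 / p) * (m : ℝ) ^ (1 / p) = L * m := by
    rw [← Real.rpow_add hm0, hL, ← Real.rpow_add_one hm0.ne']
    ring_nf
  have hc2 : L * (m * c ^ 2) = 4 * A ^ 2 := by
    linear_combination ((m : ℝ) ^ (1 / p) * c + 2 * A) * hcA - c ^ 2 * hmL
  have h4 : (4 * m : ℝ) ^ (1 / p) * c ≤ 8 * A := by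
    have h41 : (4 : ℝ) ^ (1 / p) ≤ 4 := by
      conv_rhs => rw [← Real.rpow_one 4]
      exact Real.rpow_le_rpow_of_exponent_le (by norm_num) (by rw [div_le_one hp0]; exact hp)
    rw [Real.mul_rpow (by norm_num) hm0.le, mul_assoc, hcA]
    nlinarith
  have key := integral_exp_lpNorm_empirical_sum_le (densMeasure 𝔭) hp hp2
    (measurable_empSummand hK h𝔭 m) hB
    (fun z => (lpNorm_empSummand_le hK h𝔭 hp hh m z).1)
    (fun z => (lpNorm_empSummand_le hK h𝔭 hp hh m z).2) (integral_empSummand hK h𝔭 m) m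
    (t := L / A) (by positivity) (128 * A)
  simp only [empProc_eq_sum h𝔭]
  refine key.trans (Real.exp_le_exp.2 ?_)
  rw [← hc]
  have e1 : m * ((2 * c) ^ 2 * (L / A) ^ 2 / 2) = 8 * L := by
    have : m * ((2 * c) ^ 2 * (L / A) ^ 2 / 2) = 2 * (L * (m * c ^ 2)) * L / A ^ 2 := by
      field_simp
    rw [this, hc2]
    field_simp
    norm_num
  have e2 : L / A * ((4 * m : ℝ) ^ (1 / p) * c - 128 * A) ≤ L / A * (-120 * A) :=
    mul_le_mul_of_nonneg_left (by linarith) (by positivity)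
  have e3 : L / A * (-120 * A) = -120 * L := by field_simp
  rw [e1]
  linarith

end EmpiricalProcess

lemma max_rpow_le_exp {q t : ℝ} (hq : 0 < q) (ht : 0 < t) (u : ℝ) :
    max u 0 ^ q ≤ (q / t) ^ q * Real.exp (t * u) := by
  rcases le_total u 0 with hu | hu
  · rw [max_eq_right hu, Real.zero_rpow hq.ne']
    positivity
  · have h1 : u ≤ q / t * Real.exp (t * u / q) := by
      have h2 : t * u / q ≤ Real.exp (t * u / q) := by
        linarith [Real.add_one_le_exp (t * u / q)]
      calc u = q / t * (t * u / q) := by field_simp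
        _ ≤ _ := by gcongr
    rw [max_eq_left hu]
    refine (Real.rpow_le_rpow hu h1 hq.le).trans (le_of_eq ?_)
    rw [Real.mul_rpow (by positivity) (by positivity), ← Real.exp_mul, div_mul_cancel₀ _ hq.ne']

lemma dyadicGrid.pos {d : ℕ} {h : Fin d → ℝ} (hh : h ∈ dyadicGrid d) (j : Fin d) : 0 < h j := by
  obtain ⟨k, hk⟩ := hh
  rw [hk]
  positivity

lemma inv_le_prod_of_mem_bandwidthSet {d m : ℕ} (hm : 3 ≤ m) {h : Fin d → ℝ}
    (hh : h ∈ bandwidthSet d m) : 1 ≤ (m : ℝ) * ∏ j, h j := by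
  have hm' : (3 : ℝ) ≤ m := by exact_mod_cast hm
  have hlog : 1 ≤ Real.log m := by
    rw [Real.le_log_iff_exp_le (by linarith)]
    linarith [Real.exp_one_lt_d9]
  have := (div_le_iff₀ (by linarith)).1 hh.2.1
  linarith

/-- The bandwidths of the dyadic grid indexed by exponents below `m`. -/
def dyadicBandwidth {d m : ℕ} (k : Fin d → Fin m) (j : Fin d) : ℝ :=
  (2 : ℝ) ^ (-((k j : ℕ) : ℤ))

lemma exists_dyadicBandwidth_eq {d m : ℕ} (hm : 3 ≤ m) {h : Fin d → ℝ}
    (hh : h ∈ bandwidthSet d m) : ∃ k : Fin d → Fin m, dyadicBandwidth k = h := by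
  have hpos := dyadicGrid.pos hh.1
  have hV := inv_le_prod_of_mem_bandwidthSet hm hh
  obtain ⟨k, hk⟩ := hh.1
  have hle : ∀ j, h j ≤ 1 := fun j => by
    rw [hk, zpow_neg, zpow_natCast]
    exact inv_le_one_of_one_le₀ (one_le_pow₀ (by norm_num))
  have hkm : ∀ j, k j < m := fun j => by
    have h1 : ∏ i, h i ≤ h j := by
      rw [← Finset.mul_prod_erase _ _ (Finset.mem_univ j)]
      exact mul_le_of_le_one_right (hpos j).le
        (Finset.prod_le_one (fun i _ => (hpos i).le) fun i _ => hle i)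
    have h2 : (1 : ℝ) ≤ m * h j :=
      hV.trans (mul_le_mul_of_nonneg_left h1 (Nat.cast_nonneg m))
    rw [hk, zpow_neg, zpow_natCast, ← div_eq_mul_inv, le_div_iff₀ (by positivity), one_mul] at h2
    exact Nat.lt_two_pow_self.trans_le (by exact_mod_cast h2)
  exact ⟨fun j => ⟨k j, hkm j⟩, funext fun j => (hk j).symm⟩

lemma tendsto_rpow_mul_superpolynomial (d : ℕ) (C : ℝ) {s b : ℝ} (hs : 0 < s) (hb : 0 < b)
    (a : ℝ) :
    Tendsto (fun m : ℕ => (m : ℝ) ^ a * ((m : ℝ) ^ d * C * Real.exp (-b * (m : ℝ) ^ s)))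
      atTop (nhds 0) := by
  have h1 := ((tendsto_rpow_mul_exp_neg_mul_atTop_nhds_zero ((a + d) / s) b hb).comp
    ((tendsto_rpow_atTop hs).comp tendsto_natCast_atTop_atTop)).const_mul C
  rw [mul_zero] at h1
  refine h1.congr' ?_
  filter_upwards [eventually_gt_atTop 0] with m hm
  have hm0 : (0 : ℝ) < m := by exact_mod_cast hm
  simp only [Function.comp_apply]
  rw [← Real.rpow_mul hm0.le, mul_div_cancel₀ _ hs.ne', Real.rpow_add hm0, Real.rpow_natCast]
  ring

section MainBound

variable {d : ℕ} {K : (Fin d → ℝ) → ℝ} {p : ℝ} {𝔭 : (Fin d → ℝ) → ℝ} {h : Fin d → ℝ}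

lemma inv_mul_deltaLow (hK : IsGoodKernel K) (m : ℕ) :
    (_root_.lpNorm 1 K)⁻¹ * deltaLow K p m h
      = 128 * (_root_.lpNorm p K * ((m : ℝ) * ∏ j, h j) ^ (1 / p - 1)) := by
  have := (hK.lpNorm_pos le_rfl).ne'
  rw [deltaLow]
  field_simp

lemma lpNorm_empProc_le_threshold (hK : IsGoodKernel K) (h𝔭 : IsDensity 𝔭) (hp : 1 ≤ p)
    (hh : ∀ j, 0 < h j) {m : ℕ} (hm : 1 ≤ m) (hm2 : m ≤ 2) (ω : Fin m → Fin d → ℝ) :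
    _root_.lpNorm p (fun x => empProc K 𝔭 m ω x h)
      ≤ 128 * (_root_.lpNorm p K * ((m : ℝ) * ∏ j, h j) ^ (1 / p - 1)) := by
  have hp0 : 0 < p := by linarith
  have hV : 0 < ∏ j, h j := Finset.prod_pos fun j _ => hh j
  have hm1 : (1 : ℝ) ≤ m := by exact_mod_cast hm
  have hm2' : (m : ℝ) ≤ 2 := by exact_mod_cast hm2
  refine (lpNorm_empProc_le hK h𝔭 hp hh hm ω).trans ?_
  have hpow : (1 / 2 : ℝ) ≤ (m : ℝ) ^ (1 / p - 1) := by
    calc (1 / 2 : ℝ) ≤ (m : ℝ) ^ (-1 : ℝ) := by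
          rw [Real.rpow_neg_one, one_div]
          exact inv_anti₀ (by linarith) hm2'
      _ ≤ _ := Real.rpow_le_rpow_of_exponent_le hm1 (by
          have : 0 < 1 / p := by positivity
          linarith)
  rw [Real.mul_rpow (by linarith) hV.le]
  have hX : 0 ≤ _root_.lpNorm p K * (∏ j, h j) ^ (1 / p - 1) :=
    mul_nonneg (lpNorm_nonneg _ _) (by positivity)
  nlinarith

/-- One exponential term dominating the excess over the threshold at bandwidth `h`. -/
def excessMajorant {d : ℕ} (K : (Fin d → ℝ) → ℝ) (𝔭 : (Fin d → ℝ) → ℝ) (p q : ℝ) (m : ℕ)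
    (h : Fin d → ℝ) (ω : Fin m → Fin d → ℝ) : ℝ :=
  (q * _root_.lpNorm p K) ^ q * Real.exp
    ((m : ℝ) ^ (2 / p - 1) / (_root_.lpNorm p K * ((m : ℝ) * ∏ j, h j) ^ (1 / p - 1)) *
      (_root_.lpNorm p (fun x => empProc K 𝔭 m ω x h)
        - 128 * (_root_.lpNorm p K * ((m : ℝ) * ∏ j, h j) ^ (1 / p - 1))))

lemma excessMajorant_nonneg {q : ℝ} (hq : 0 ≤ q) (m : ℕ) (ω : Fin m → Fin d → ℝ) :
    0 ≤ excessMajorant K 𝔭 p q m h ω :=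
  mul_nonneg (Real.rpow_nonneg (mul_nonneg hq (lpNorm_nonneg _ _)) _) (Real.exp_pos _).le

lemma excess_rpow_le_excessMajorant (hK : IsGoodKernel K) (hp : 1 ≤ p) (hp2 : p ≤ 2) {q : ℝ}
    (hq : 0 < q) {m : ℕ} (hm : 1 ≤ m) (hmV : 1 ≤ (m : ℝ) * ∏ j, h j) (ω : Fin m → Fin d → ℝ) :
    max (_root_.lpNorm p (fun x => empProc K 𝔭 m ω x h)
        - (_root_.lpNorm 1 K)⁻¹ * deltaLow K p m h) 0 ^ q ≤ excessMajorant K 𝔭 p q m h ω := by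
  have hp0 : 0 < p := by linarith
  have hm1 : (1 : ℝ) ≤ m := by exact_mod_cast hm
  have hKp : 0 < _root_.lpNorm p K := hK.lpNorm_pos hp
  have hL1 : 1 ≤ (m : ℝ) ^ (2 / p - 1) := Real.one_le_rpow hm1 (by
    rw [sub_nonneg, le_div_iff₀ hp0]; linarith)
  have hr1 : ((m : ℝ) * ∏ j, h j) ^ (1 / p - 1) ≤ 1 :=
    Real.rpow_le_one_of_one_le_of_nonpos hmV (by
      rw [sub_nonpos, div_le_iff₀ hp0]; linarith)
  have hr0 : 0 < ((m : ℝ) * ∏ j, h j) ^ (1 / p - 1) := by positivity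
  rw [inv_mul_deltaLow hK, excessMajorant]
  refine (max_rpow_le_exp hq (t := (m : ℝ) ^ (2 / p - 1)
    / (_root_.lpNorm p K * ((m : ℝ) * ∏ j, h j) ^ (1 / p - 1))) (by positivity) _).trans ?_
  refine mul_le_mul_of_nonneg_right (Real.rpow_le_rpow (by positivity) ?_ hq.le)
    (Real.exp_pos _).le
  rw [div_div_eq_mul_div, div_le_iff₀ (by positivity)]
  calc q * (_root_.lpNorm p K * ((m : ℝ) * ∏ j, h j) ^ (1 / p - 1))
      ≤ q * (_root_.lpNorm p K * 1) := by gcongr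
    _ ≤ q * _root_.lpNorm p K * (m : ℝ) ^ (2 / p - 1) := by
        rw [mul_one]
        exact le_mul_of_one_le_right (by positivity) hL1

lemma excessMajorant_integral (hK : IsGoodKernel K) (h𝔭 : IsDensity 𝔭) (hp : 1 ≤ p) (hp2 : p ≤ 2)
    {q : ℝ} (hq : 0 ≤ q) (hh : ∀ j, 0 < h j) {m : ℕ} (hm : 1 ≤ m) :
    Integrable (excessMajorant K 𝔭 p q m h) (sampleMeasure 𝔭 m) ∧
      ∫ ω, excessMajorant K 𝔭 p q m h ω ∂(sampleMeasure 𝔭 m)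
        ≤ (q * _root_.lpNorm p K) ^ q * Real.exp (-(m : ℝ) ^ (2 / p - 1)) := by
  have hV : 0 < ∏ j, h j := Finset.prod_pos fun j _ => hh j
  have hKp : 0 ≤ _root_.lpNorm p K := lpNorm_nonneg _ _
  refine ⟨(integrable_exp_lpNorm_empProc hK h𝔭 hp hh m (by positivity) _).const_mul _, ?_⟩
  simp only [excessMajorant]
  rw [integral_const_mul]
  exact mul_le_mul_of_nonneg_left (integral_exp_lpNorm_empProc_le hK h𝔭 hp hp2 hh hm rfl rfl)
    (by positivity)

lemma integral_iSup_excess_le (hK : IsGoodKernel K) (h𝔭 : IsDensity 𝔭) (hp : 1 ≤ p) (hp2 : p ≤ 2)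
    {q : ℝ} (hq : 0 < q) {m : ℕ} (hm : 1 ≤ m) :
    ∫ ω, (⨆ h ∈ bandwidthSet d m,
          max (_root_.lpNorm p (fun x => empProc K 𝔭 m ω x h)
                - (_root_.lpNorm 1 K)⁻¹ * deltaLow K p m h) 0) ^ q ∂(sampleMeasure 𝔭 m)
      ≤ (m : ℝ) ^ d * ((q * _root_.lpNorm p K) ^ q * Real.exp (-(m : ℝ) ^ (2 / p - 1))) := by
  have hKp : 0 ≤ _root_.lpNorm p K := lpNorm_nonneg _ _
  have hsup0 : ∀ ω : Fin m → Fin d → ℝ, 0 ≤ ⨆ h ∈ bandwidthSet d m,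
      max (_root_.lpNorm p (fun x => empProc K 𝔭 m ω x h)
        - (_root_.lpNorm 1 K)⁻¹ * deltaLow K p m h) 0 := fun ω =>
    Real.iSup_nonneg fun h => Real.iSup_nonneg fun _ => le_max_right _ _
  rcases le_or_gt m 2 with hm2 | hm3
  · have hzero : ∀ ω : Fin m → Fin d → ℝ, (⨆ h ∈ bandwidthSet d m,
        max (_root_.lpNorm p (fun x => empProc K 𝔭 m ω x h)
          - (_root_.lpNorm 1 K)⁻¹ * deltaLow K p m h) 0) = 0 := fun ω => by
      refine le_antisymm (Real.iSup_le (fun h => Real.iSup_le (fun hh => ?_) le_rfl) le_rfl)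
        (hsup0 ω)
      refine max_le (sub_nonpos.2 ?_) le_rfl
      rw [inv_mul_deltaLow hK]
      exact lpNorm_empProc_le_threshold hK h𝔭 hp (dyadicGrid.pos hh.1) hm hm2 ω
    simp only [hzero, Real.zero_rpow hq.ne', integral_zero]
    positivity
  · have hpos : ∀ (k : Fin d → Fin m) j, 0 < dyadicBandwidth k j := fun k j => by
      rw [dyadicBandwidth]; positivity
    have hmaj := fun k : Fin d → Fin m =>
      excessMajorant_integral hK h𝔭 hp hp2 hq.le (hpos k) hm
    calc _ ≤ ∫ ω, ∑ k : Fin d → Fin m, excessMajorant K 𝔭 p q m (dyadicBandwidth k) ω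
            ∂(sampleMeasure 𝔭 m) := by
          refine integral_mono_of_nonneg
            (Eventually.of_forall fun ω => Real.rpow_nonneg (hsup0 ω) _)
            (integrable_finsetSum _ fun k _ => (hmaj k).1) (Eventually.of_forall fun ω => ?_)
          have hS0 : 0 ≤ ∑ k : Fin d → Fin m, excessMajorant K 𝔭 p q m (dyadicBandwidth k) ω :=
            Finset.sum_nonneg fun k _ => excessMajorant_nonneg hq.le m ω
          refine (Real.le_rpow_inv_iff_of_pos (hsup0 ω) hS0 hq).1 ?_
          refine Real.iSup_le (fun h => Real.iSup_le (fun hh => ?_) (by positivity)) (by positivity)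
          refine (Real.le_rpow_inv_iff_of_pos (le_max_right _ _) hS0 hq).2 ?_
          obtain ⟨k, rfl⟩ := exists_dyadicBandwidth_eq hm3 hh
          refine (excess_rpow_le_excessMajorant hK hp hp2 hq hm
            (inv_le_prod_of_mem_bandwidthSet hm3 hh) ω).trans ?_
          exact Finset.single_le_sum
            (f := fun k : Fin d → Fin m => excessMajorant K 𝔭 p q m (dyadicBandwidth k) ω)
            (fun k _ => excessMajorant_nonneg hq.le m ω) (Finset.mem_univ k)
      _ = ∑ k : Fin d → Fin m, ∫ ω, excessMajorant K 𝔭 p q m (dyadicBandwidth k) ω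
            ∂(sampleMeasure 𝔭 m) := integral_finsetSum _ fun k _ => (hmaj k).1
      _ ≤ _ := by
          refine (Finset.sum_le_sum fun k _ => (hmaj k).2).trans (le_of_eq ?_)
          simp

end MainBound

/-- Lemma 1, case `1 ≤ p < 2`: the deterministic thresholds
`‖K‖₁⁻¹ Δ_m(h)` are upper functions, over all probability densities, for the `L_p`-norms
of the smoothed empirical processes, at a level `ε_m(p)` decreasing faster than any
power of `m`. -/
theorem upper_function_empirical_process_p_lt_two
    (d : ℕ) (hd : 0 < d) (K : (Fin d → ℝ) → ℝ) (hK : IsGoodKernel K)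
    (p q : ℝ) (hp1 : 1 ≤ p) (hp2 : p < 2) (hq : 1 ≤ q) :
    ∃ ε : ℕ → ℝ,
      (∀ a : ℝ, 0 < a →
        Tendsto (fun m : ℕ => (m : ℝ) ^ a * ε m) atTop (nhds 0)) ∧
      ∀ m : ℕ, 1 ≤ m → ∀ 𝔭 : (Fin d → ℝ) → ℝ, IsDensity 𝔭 →
        ∫ ω, (⨆ h ∈ bandwidthSet d m,
              max (lpNorm p (fun x => empProc K 𝔭 m ω x h)
                    - (lpNorm 1 K)⁻¹ * deltaLow K p m h) 0) ^ q
            ∂(sampleMeasure 𝔭 m)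
          ≤ ε m ^ q := by
  have hp0 : 0 < p := by linarith
  have hq0 : 0 < q := by linarith
  have hKp : 0 ≤ _root_.lpNorm p K := lpNorm_nonneg _ _
  refine ⟨fun m => (m : ℝ) ^ d * (q * _root_.lpNorm p K)
    * Real.exp (-q⁻¹ * (m : ℝ) ^ (2 / p - 1)), fun a _ => ?_, fun m hm 𝔭 h𝔭 => ?_⟩
  · exact tendsto_rpow_mul_superpolynomial d _ (by rw [sub_pos, lt_div_iff₀ hp0]; linarith)
      (inv_pos.2 hq0) a
  · refine (integral_iSup_excess_le hK h𝔭 hp1 hp2.le hq0 hm).trans ?_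
    have hm1 : (1 : ℝ) ≤ (m : ℝ) ^ d := one_le_pow₀ (by exact_mod_cast hm)
    beta_reduce
    have hE := Real.exp_pos (-q⁻¹ * (m : ℝ) ^ (2 / p - 1))
    have hpow : Real.exp (-q⁻¹ * (m : ℝ) ^ (2 / p - 1)) ^ q =
        Real.exp (-(m : ℝ) ^ (2 / p - 1)) := by
      rw [← Real.exp_mul]
      congr 1
      field_simp
    rw [mul_assoc ((m : ℝ) ^ d) (q * _root_.lpNorm p K),
      Real.mul_rpow (x := (m : ℝ) ^ d) (by positivity) (by positivity),
      Real.mul_rpow (x := q * _root_.lpNorm p K)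
        (y := Real.exp (-q⁻¹ * (m : ℝ) ^ (2 / p - 1))) (by positivity) hE.le, hpow]
    exact mul_le_mul_of_nonneg_right (Real.self_le_rpow_of_one_le hm1 hq) (by positivity)

end
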